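/- arXiv:2210.08530 — 6 statements merged into one kernel-verified Lean document; each statement's English description precedes it below -/
import Mathlib

section
/- Let m, l ∈ ℕ, let g : EuclideanSpace ℝ (Fin m) → EuclideanSpace ℝ (Fin l) be a function and let U ⊆ EuclideanSpace ℝ (Fin m) be an open set. Then g is differentiable on U (DifferentiableOn ℝ g U) if and only if for every n ∈ ℕ and every differentiable map α : EuclideanSpace ℝ (Fin n) → EuclideanSpace ℝ (Fin m) with Set.range α ⊆ U, the composite g ∘ α is differentiable on all of EuclideanSpace ℝ (Fin n). -/
/-- Characterization of differentiability of a partially defined function with open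
domain `U` by precomposition with all total differentiable maps landing in `U`. -/
theorem differentiableOn_iff_precomposition
    (m l : ℕ) (g : EuclideanSpace ℝ (Fin m) → EuclideanSpace ℝ (Fin l))
    (U : Set (EuclideanSpace ℝ (Fin m))) (hU : IsOpen U) :
    DifferentiableOn ℝ g U ↔
      (∀ (n : ℕ) (α : EuclideanSpace ℝ (Fin n) → EuclideanSpace ℝ (Fin m)),
        Differentiable ℝ α → Set.range α ⊆ U → Differentiable ℝ (g ∘ α)) := by
  constructor
  · intro h n α hα hr x
    have hx : α x ∈ U := hr ⟨x, rfl⟩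
    exact ((h _ hx).differentiableAt (hU.mem_nhds hx)).comp x (hα x)
  · intro h x hx
    obtain ⟨ε, hε, hball⟩ := Metric.isOpen_iff.mp hU x hx
    let e : OpenPartialHomeomorph (EuclideanSpace ℝ (Fin m)) (EuclideanSpace ℝ (Fin m)) :=
      OpenPartialHomeomorph.univBall x ε
    have htarget : e.target = Metric.ball x ε := OpenPartialHomeomorph.univBall_target x hε
    have hsource : e.source = Set.univ := OpenPartialHomeomorph.univBall_source x ε
    have hd : Differentiable ℝ e :=
      (OpenPartialHomeomorph.contDiff_univBall (n := 1)).differentiable one_ne_zero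
    have hs : DifferentiableOn ℝ e.symm (Metric.ball x ε) :=
      (OpenPartialHomeomorph.contDiffOn_univBall_symm (n := 1)).differentiableOn one_ne_zero
    have hge : Differentiable ℝ (g ∘ e) := by
      refine h m e hd ?_
      rintro _ ⟨y, rfl⟩
      apply hball
      rw [← htarget]
      exact e.map_source (by rw [hsource]; trivial)
    have hnhds : Metric.ball x ε ∈ nhds x := Metric.ball_mem_nhds x hε
    have hsx : DifferentiableAt ℝ e.symm x := hs.differentiableAt hnhds
    have hcomp : DifferentiableAt ℝ ((g ∘ e) ∘ e.symm) x := (hge _).comp x hsx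
    refine (hcomp.congr_of_eventuallyEq ?_).differentiableWithinAt
    filter_upwards [hnhds] with y hy
    rw [← htarget] at hy
    simp only [Function.comp_apply, e.right_inv hy]
end

section
/- Let m, l ∈ ℕ, let g : EuclideanSpace ℝ (Fin m) → EuclideanSpace ℝ (Fin l), let U ⊆ EuclideanSpace ℝ (Fin m) be open, and let D : EuclideanSpace ℝ (Fin m) → (EuclideanSpace ℝ (Fin m) →L[ℝ] EuclideanSpace ℝ (Fin l)) be a candidate derivative assignment. Then the following are equivalent: (i) for every x ∈ U, g has Fréchet derivative D x at x (HasFDerivAt g (D x) x); (ii) for every n ∈ ℕ and every differentiable α : EuclideanSpace ℝ (Fin n) → EuclideanSpace ℝ (Fin m) with Set.range α ⊆ U, the composite g ∘ α is differentiable and fderiv ℝ (g ∘ α) y = (D (α y)).comp (fderiv ℝ α y) for all y. -/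
/-- Characterization of differentiability and the derivative of a partially defined
function with open domain `U` by precomposition with all total differentiable maps
landing in `U`. -/
theorem hasFDerivAt_on_open_iff_precomposition
    (m l : ℕ) (g : EuclideanSpace ℝ (Fin m) → EuclideanSpace ℝ (Fin l))
    (U : Set (EuclideanSpace ℝ (Fin m))) (hU : IsOpen U)
    (D : EuclideanSpace ℝ (Fin m) →
      (EuclideanSpace ℝ (Fin m) →L[ℝ] EuclideanSpace ℝ (Fin l))) :
    (∀ x ∈ U, HasFDerivAt g (D x) x) ↔
      (∀ (n : ℕ) (α : EuclideanSpace ℝ (Fin n) → EuclideanSpace ℝ (Fin m)),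
        Differentiable ℝ α → Set.range α ⊆ U →
        Differentiable ℝ (g ∘ α) ∧
          ∀ y, fderiv ℝ (g ∘ α) y = (D (α y)).comp (fderiv ℝ α y)) := by
  constructor
  · intro h n α hα hr
    have key : ∀ y, HasFDerivAt (g ∘ α) ((D (α y)).comp (fderiv ℝ α y)) y := fun y =>
      (h (α y) (hr ⟨y, rfl⟩)).comp y (hα y).hasFDerivAt
    exact ⟨fun y => (key y).differentiableAt, fun y => (key y).fderiv⟩
  · intro h x hx
    obtain ⟨r, hr, hball⟩ := Metric.isOpen_iff.mp hU x hx
    let φ : ContDiffBump x := ⟨r / 2, r, by positivity, by linarith⟩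
    let α : EuclideanSpace ℝ (Fin m) → EuclideanSpace ℝ (Fin m) :=
      fun y => x + φ y • (y - x)
    have hφ : Differentiable ℝ φ := (φ.contDiff (n := 1)).differentiable (by simp)
    have hα : Differentiable ℝ α :=
      (differentiable_const x).add (hφ.smul (differentiable_id.sub (differentiable_const x)))
    have hrange : Set.range α ⊆ U := by
      rintro _ ⟨y, rfl⟩
      apply hball
      rw [Metric.mem_ball, dist_eq_norm]
      have e : α y - x = φ y • (y - x) := by simp [α]
      rw [e, norm_smul, Real.norm_of_nonneg φ.nonneg]
      by_cases hy : dist y x < r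
      · rw [dist_eq_norm] at hy
        exact (mul_le_of_le_one_left (norm_nonneg _) φ.le_one).trans_lt hy
      · have h0 : φ y = 0 := φ.zero_of_le_dist (not_lt.mp hy)
        simpa [h0] using hr
    have hid : α =ᶠ[nhds x] id := by
      filter_upwards [φ.eventuallyEq_one] with y hy
      have hy1 : φ y = 1 := hy
      simp [α, hy1]
    have hαx : α x = x := hid.eq_of_nhds
    obtain ⟨hd, hf⟩ := h m α hα hrange
    have h1 := (hd x).hasFDerivAt
    rw [hf x, hid.fderiv_eq, fderiv_id, hαx, ContinuousLinearMap.comp_id] at h1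
    exact h1.congr_of_eventuallyEq (hid.fun_comp g).symm
end

section
/- Let n, m ∈ ℕ and let f : ℕ → (EuclideanSpace ℝ (Fin n) →. EuclideanSpace ℝ (Fin m)) be a sequence of partial functions such that for every k, f (k+1) extends f k (i.e., for all x and y, y ∈ f k x implies y ∈ f (k+1) x). Suppose that for every k the domain Dₖ = (f k).Dom is open and there is a function gₖ with DifferentiableOn ℝ gₖ Dₖ and gₖ x ∈ f k x for all x ∈ Dₖ. Let F be the partial function with domain ⋃ₖ Dₖ that agrees with f k on Dₖ for every k. Then the domain of F is open, F is differentiable on its domain (there is G with DifferentiableOn ℝ G (⋃ₖ Dₖ) and G x ∈ F x for all x in the domain), and for every k and every x ∈ Dₖ the Fréchet derivative of F at x equals the Fréchet derivative of f k at x. -/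
/-- Admissibility of the predicate "open domain and differentiable on the domain"
for ω-chains of partial functions: if `f : ℕ → (ℝⁿ →. ℝᵐ)` is a chain for the
extension order whose members all have open domain and are differentiable there,
then its supremum `F` (the partial function with domain `⋃ₖ (f k).Dom` agreeing
with each `f k` on its domain) has open domain, is differentiable on its domain,
and its derivative at any `x ∈ (f k).Dom` agrees with the derivative of `f k`. -/
theorem partial_differentiable_admissible
    (n m : ℕ)
    (f : ℕ → (EuclideanSpace ℝ (Fin n) →. EuclideanSpace ℝ (Fin m)))
    (hchain : ∀ k x y, y ∈ f k x → y ∈ f (k + 1) x)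
    (hopen : ∀ k, IsOpen ((f k).Dom))
    (hdiff : ∀ k, ∃ g, DifferentiableOn ℝ g ((f k).Dom) ∧
      ∀ x ∈ (f k).Dom, g x ∈ f k x)
    (F : EuclideanSpace ℝ (Fin n) →. EuclideanSpace ℝ (Fin m))
    (hFdom : F.Dom = ⋃ k, (f k).Dom)
    (hFagree : ∀ k x, x ∈ (f k).Dom → F x = f k x) :
    IsOpen F.Dom ∧
    (∃ G, DifferentiableOn ℝ G F.Dom ∧ ∀ x ∈ F.Dom, G x ∈ F x) ∧
    (∀ k (G g : EuclideanSpace ℝ (Fin n) → EuclideanSpace ℝ (Fin m)),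
      DifferentiableOn ℝ G F.Dom → (∀ x ∈ F.Dom, G x ∈ F x) →
      DifferentiableOn ℝ g ((f k).Dom) → (∀ x ∈ (f k).Dom, g x ∈ f k x) →
      ∀ x ∈ (f k).Dom, fderiv ℝ G x = fderiv ℝ g x) := by
  classical
  have hsub : ∀ k, ∀ x ∈ (f k).Dom, x ∈ F.Dom := by
    intro k x hx
    rw [hFdom]
    exact Set.mem_iUnion.2 ⟨k, hx⟩
  have key : ∀ k (G g : EuclideanSpace ℝ (Fin n) → EuclideanSpace ℝ (Fin m)),
      (∀ x ∈ F.Dom, G x ∈ F x) → (∀ x ∈ (f k).Dom, g x ∈ f k x) →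
      ∀ x ∈ (f k).Dom, G =ᶠ[nhds x] g := by
    intro k G g hG hg x hx
    filter_upwards [(hopen k).mem_nhds hx] with y hy
    have h1 := hG y (hsub k y hy)
    rw [hFagree k y hy] at h1
    exact Part.mem_unique h1 (hg y hy)
  refine ⟨?_, ?_, ?_⟩
  · rw [hFdom]
    exact isOpen_iUnion hopen
  · have hex : ∀ x, ∃ y, x ∈ F.Dom → y ∈ F x := by
      intro x
      by_cases hx : x ∈ F.Dom
      · exact ⟨(F x).get hx, fun _ => Part.get_mem hx⟩
      · exact ⟨0, fun h => absurd h hx⟩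
    choose G hG using hex
    refine ⟨G, ?_, hG⟩
    intro x hx
    rw [hFdom] at hx
    obtain ⟨k, hk⟩ := Set.mem_iUnion.1 hx
    obtain ⟨g, hgd, hg⟩ := hdiff k
    have hat : DifferentiableAt ℝ g x := hgd.differentiableAt ((hopen k).mem_nhds hk)
    exact (hat.congr_of_eventuallyEq (key k G g hG hg x hk)).differentiableWithinAt
  · intro k G g _ hG _ hg x hx
    exact (key k G g hG hg x hx).fderiv_eq
end

section
/- Let C and D be categories such that D has binary products, and let G : C ⥤ D be any functor. Then the projection functor P : Comma (𝟭 D) G ⥤ D × C, sending an object (d, c, j : d ⟶ G c) to (d, c), has a right adjoint, given on objects by (d, c) ↦ (d × G c, c, π₂ : d × G c ⟶ G c), and P is comonadic. -/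
open CategoryTheory CategoryTheory.Limits

namespace SconeAux

/-- The projection. -/
abbrev P {C : Type*} {D : Type*} [Category C] [Category D] (G : C ⥤ D) :
    Comma (𝟭 D) G ⥤ D × C := (Comma.fst (𝟭 D) G).prod' (Comma.snd (𝟭 D) G)

/-- The right adjoint. -/
noncomputable def R {C : Type*} {D : Type*} [Category C] [Category D]
    [HasBinaryProducts D] (G : C ⥤ D) : D × C ⥤ Comma (𝟭 D) G where
  obj X := { left := X.1 ⨯ G.obj X.2, right := X.2, hom := Limits.prod.snd }
  map f := { left := Limits.prod.map f.1 (G.map f.2), right := f.2, w := by simp }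
  map_id X := by ext <;> simp
  map_comp f g := by ext <;> simp

theorem nat_aux {D : Type*} [Category D] [HasBinaryProducts D] {a b x y : D}
    (f : a ⟶ b) (g : x ⟶ y) (j : a ⟶ x) (k : b ⟶ y) (w : f ≫ k = j ≫ g) :
    f ≫ Limits.prod.lift (𝟙 b) k = Limits.prod.lift (𝟙 a) j ≫ Limits.prod.map f g := by
  apply Limits.prod.hom_ext
  · rw [Category.assoc, Category.assoc, Limits.prod.map_fst, Limits.prod.lift_fst,
      ← Category.assoc, Limits.prod.lift_fst, Category.comp_id, Category.id_comp]
  · rw [Category.assoc, Category.assoc, Limits.prod.map_snd, Limits.prod.lift_snd,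
      ← Category.assoc, Limits.prod.lift_snd, w]

theorem nat_aux_conv {D : Type*} [Category D] [HasBinaryProducts D] {a b x y : D}
    (f : a ⟶ b) (g : x ⟶ y) (j : a ⟶ x) (k : b ⟶ y)
    (w : Limits.prod.lift (𝟙 a) j ≫ Limits.prod.map f g = f ≫ Limits.prod.lift (𝟙 b) k) :
    f ≫ k = j ≫ g := by
  have e2 := congrArg (fun t => t ≫ Limits.prod.snd) w
  rw [Category.assoc, Category.assoc, Limits.prod.map_snd, Limits.prod.lift_snd,
    ← Category.assoc, Limits.prod.lift_snd] at e2
  exact e2.symm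

theorem tri_aux {D : Type*} [Category D] [HasBinaryProducts D] (a x : D) (g : x ⟶ x)
    (hg : g = 𝟙 x) :
    Limits.prod.lift (𝟙 (a ⨯ x)) Limits.prod.snd ≫ Limits.prod.map Limits.prod.fst g =
      𝟙 (a ⨯ x) := by
  subst hg
  apply Limits.prod.hom_ext <;> simp

/-- The adjunction. -/
noncomputable def adj {C : Type*} {D : Type*} [Category C] [Category D]
    [HasBinaryProducts D] (G : C ⥤ D) : P G ⊣ R G where
  unit :=
    { app := fun X =>
        { left := Limits.prod.lift (𝟙 X.left) X.hom
          right := 𝟙 X.right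
          w := (Limits.prod.lift_snd (𝟙 X.left) X.hom).trans
            (((congrArg (fun t => X.hom ≫ t) (G.map_id X.right)).trans
              (Category.comp_id X.hom)).symm) }
      naturality := fun X Y f => by
        apply CommaMorphism.ext
        · exact nat_aux f.left (G.map f.right) X.hom Y.hom f.w
        · exact (Category.comp_id f.right).trans (Category.id_comp f.right).symm }
  counit :=
    { app := fun X => (Limits.prod.fst, 𝟙 X.2)
      naturality := fun X Y f => by
        apply Prod.ext
        · exact Limits.prod.map_fst f.1 (G.map f.2)
        · exact (Category.comp_id f.2).trans (Category.id_comp f.2).symm }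
  left_triangle_components X := by
    apply Prod.ext
    · exact Limits.prod.lift_fst (𝟙 X.left) X.hom
    · exact Category.comp_id (𝟙 X.right)
  right_triangle_components X := by
    apply CommaMorphism.ext
    · exact tri_aux X.1 (G.obj X.2) _ (G.map_id X.2)
    · exact Category.comp_id (𝟙 X.2)

theorem eqv {C : Type*} {D : Type*} [Category C] [Category D]
    [HasBinaryProducts D] (G : C ⥤ D) : (Comonad.comparison (adj G)).IsEquivalence where
  faithful := ⟨fun {X Y} f g h => by
    have h1 : (P G).map f = (P G).map g := congrArg Comonad.Coalgebra.Hom.f h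
    apply CommaMorphism.ext
    · exact congrArg (fun t => t.1) h1
    · exact congrArg (fun t => t.2) h1⟩
  full := ⟨fun {X Y} h => by
    have e := nat_aux_conv (D := D) (a := X.left) (b := Y.left) h.f.1 (G.map h.f.2) X.hom Y.hom
      (congrArg (fun t => t.1) h.h)
    exact ⟨{ left := h.f.1, right := h.f.2, w := e }, rfl⟩⟩
  essSurj := ⟨fun A => by
    let d : D := A.A.1
    let c : C := A.A.2
    let a : d ⟶ d ⨯ G.obj c := A.a.1
    let b : c ⟶ c := A.a.2
    have c1 : a ≫ Limits.prod.fst = 𝟙 d := congrArg (fun t => t.1) A.counit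
    have c2 : b ≫ 𝟙 c = 𝟙 c := congrArg (fun t => t.2) A.counit
    rw [Category.comp_id] at c2
    let X : Comma (𝟭 D) G :=
      { left := d, right := c, hom := a ≫ Limits.prod.snd }
    have key : ((Comonad.comparison (adj G)).obj X).a = A.a := by
      apply Prod.ext
      · change Limits.prod.lift (𝟙 d) (a ≫ Limits.prod.snd) = a
        apply Limits.prod.hom_ext
        · rw [Limits.prod.lift_fst]; exact c1.symm
        · rw [Limits.prod.lift_snd]
      · exact c2.symm
    refine ⟨X, ⟨Comonad.Coalgebra.isoMk (Iso.refl A.A) ?_⟩⟩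
    rw [key]
    exact ((congrArg (fun t => A.a ≫ t) ((adj G).toComonad.map_id A.A)).trans
      (Category.comp_id A.a)).trans (Category.id_comp A.a).symm⟩

end SconeAux

/-- The projection functor from the scone `Comma (𝟭 D) G` to `D × C` has a right
adjoint given on objects by `(d, c) ↦ (d ⨯ G c, c, prod.snd)`, and it is comonadic. -/
theorem scone_projection_comonadic
    {C : Type*} {D : Type*} [Category C] [Category D]
    [HasBinaryProducts D] (G : C ⥤ D) :
    ∃ (R : D × C ⥤ Comma (𝟭 D) G)
      (_ : ((Comma.fst (𝟭 D) G).prod' (Comma.snd (𝟭 D) G)) ⊣ R),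
      (∀ (d : D) (c : C), (R.obj (d, c)).left = (d ⨯ G.obj c)) ∧
      (∀ (d : D) (c : C), (R.obj (d, c)).right = c) ∧
      (∀ (d : D) (c : C), HEq (R.obj (d, c)).hom
        (Limits.prod.snd : d ⨯ G.obj c ⟶ G.obj c)) ∧
      Nonempty (ComonadicLeftAdjoint
        ((Comma.fst (𝟭 D) G).prod' (Comma.snd (𝟭 D) G))) := by
  exact ⟨SconeAux.R G, SconeAux.adj G, fun _ _ => rfl, fun _ _ => rfl, fun _ _ => HEq.rfl,
    ⟨{ R := SconeAux.R G, adj := SconeAux.adj G, eqv := SconeAux.eqv G }⟩⟩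
end

section
/- Let C and D be categories such that C has binary coproducts, and let G : C ⥤ D be a functor admitting a left adjoint F : D ⥤ C. Then the projection functor P : Comma (𝟭 D) G ⥤ D × C, sending an object (d, c, j : d ⟶ G c) to (d, c), has a left adjoint, given on objects by (d, c) ↦ (d, F d ⨿ c, G(inl) ∘ η_d : d ⟶ G (F d ⨿ c)) where η is the unit of the adjunction F ⊣ G, and P is monadic. -/
open CategoryTheory CategoryTheory.Limits

namespace SconeMonadic

universe v₁ v₂ u₁ u₂

variable {C : Type u₁} {D : Type u₂} [Category.{v₁} C] [Category.{v₂} D]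
    [HasBinaryCoproducts C] (G : C ⥤ D) (F : D ⥤ C) (adj : F ⊣ G)

/-- The projection functor of the scone. -/
abbrev proj : Comma (𝟭 D) G ⥤ D × C :=
  (Comma.fst (𝟭 D) G).prod' (Comma.snd (𝟭 D) G)

variable {G F}

lemma aux_counit {d : D} {c : C} (j : d ⟶ G.obj c) :
    (adj.unit.app d ≫ G.map (coprod.inl : F.obj d ⟶ F.obj d ⨿ c)) ≫
      G.map (coprod.desc (F.map j ≫ adj.counit.app c) (𝟙 c)) = j := by
  rw [Category.assoc, ← G.map_comp, coprod.inl_desc, G.map_comp]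
  refine (adj.unit_naturality_assoc j (G.map (adj.counit.app c))).trans ?_
  rw [adj.right_triangle_components, Category.comp_id]

lemma aux_nat {d d' : D} {c c' : C} (j : d ⟶ G.obj c) (j' : d' ⟶ G.obj c')
    (φ : d ⟶ d') (ψ : c ⟶ c') :
    coprod.map (F.map φ) ψ ≫ coprod.desc (F.map j' ≫ adj.counit.app c') (𝟙 c') =
      coprod.desc (F.map j ≫ adj.counit.app c) (𝟙 c) ≫ ψ ↔ φ ≫ j' = j ≫ G.map ψ := by
  have e : φ ≫ j' = j ≫ G.map ψ ↔
      F.map φ ≫ F.map j' ≫ adj.counit.app c' = (F.map j ≫ adj.counit.app c) ≫ ψ := by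
    rw [← (adj.homEquiv _ _).symm.injective.eq_iff, adj.homEquiv_counit, adj.homEquiv_counit]
    simp
  rw [e]
  constructor
  · intro h
    have h1 := congrArg (fun k => coprod.inl ≫ k) h
    rwa [coprod.inl_map_assoc, coprod.inl_desc, coprod.inl_desc_assoc] at h1
  · intro h
    apply coprod.hom_ext
    · rwa [coprod.inl_map_assoc, coprod.inl_desc, coprod.inl_desc_assoc]
    · rw [coprod.inr_map_assoc, coprod.inr_desc, coprod.inr_desc_assoc,
        Category.comp_id, Category.id_comp]

lemma aux_alg {d : D} {c : C} (a : F.obj d ⨿ c ⟶ c) (h : coprod.inr ≫ a = 𝟙 c) :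
    coprod.desc (F.map (adj.unit.app d ≫ G.map (coprod.inl ≫ a)) ≫ adj.counit.app c) (𝟙 c)
      = a := by
  apply coprod.hom_ext
  · rw [coprod.inl_desc]
    simp
  · rw [coprod.inr_desc]
    exact h.symm

/-- The left adjoint of the projection. -/
noncomputable def free : D × C ⥤ Comma (𝟭 D) G where
  obj X :=
    { left := X.1
      right := F.obj X.1 ⨿ X.2
      hom := adj.unit.app X.1 ≫ G.map (coprod.inl : F.obj X.1 ⟶ F.obj X.1 ⨿ X.2) }
  map {X Y} f :=
    { left := f.1
      right := coprod.map (F.map f.1) f.2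
      w := by
        dsimp
        rw [Category.assoc, ← G.map_comp, coprod.inl_map, G.map_comp]
        exact (adj.unit_naturality_assoc f.1 _).symm }
  map_id X := by
    apply CommaMorphism.ext
    · rfl
    · simp
  map_comp f g := by
    apply CommaMorphism.ext
    · rfl
    · simp

/-- The counit of the adjunction. -/
noncomputable def counitHom (X : Comma (𝟭 D) G) :
    (free adj).obj (X.left, X.right) ⟶ X where
  left := 𝟙 X.left
  right := coprod.desc (F.map X.hom ≫ adj.counit.app X.right) (𝟙 X.right)
  w := by
    change 𝟙 X.left ≫ X.hom = (adj.unit.app X.left ≫ G.map coprod.inl) ≫ G.map _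
    rw [Category.id_comp]
    exact (aux_counit adj X.hom).symm

/-- The adjunction. -/
noncomputable def freeAdj : free adj ⊣ proj G :=
  Adjunction.mkOfUnitCounit
    { unit :=
        { app := fun X => (𝟙 X.1, (coprod.inr : X.2 ⟶ F.obj X.1 ⨿ X.2))
          naturality := fun X Y f => by
            apply Prod.ext
            · change f.1 ≫ 𝟙 _ = 𝟙 _ ≫ f.1
              simp
            · change f.2 ≫ coprod.inr = coprod.inr ≫ coprod.map (F.map f.1) f.2
              simp }
      counit :=
        { app := fun X => counitHom adj X
          naturality := fun X Y f => by
            apply CommaMorphism.ext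
            · change f.left ≫ 𝟙 _ = 𝟙 _ ≫ f.left
              simp
            · exact (aux_nat adj X.hom Y.hom f.left f.right).2 f.w }
      left_triangle := by
        ext X
        · change 𝟙 _ ≫ 𝟙 _ ≫ 𝟙 X.1 = 𝟙 X.1
          simp
        · change coprod.map (F.map (𝟙 X.1)) coprod.inr ≫ 𝟙 _ ≫
            coprod.desc (F.map (adj.unit.app X.1 ≫ G.map coprod.inl) ≫ adj.counit.app _) (𝟙 _)
              = 𝟙 (F.obj X.1 ⨿ X.2)
          apply coprod.hom_ext <;> simp
      right_triangle := by
        ext X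
        · change 𝟙 _ ≫ 𝟙 _ ≫ 𝟙 X.left = 𝟙 X.left
          simp
        · change coprod.inr ≫ 𝟙 _ ≫ coprod.desc _ (𝟙 _) = 𝟙 X.right
          rw [Category.id_comp]
          exact coprod.inr_desc _ _ }

lemma freeAdj_counit (X : Comma (𝟭 D) G) : (freeAdj adj).counit.app X = counitHom adj X := rfl

lemma comparison_full : (Monad.comparison (freeAdj adj)).Full where
  map_surjective {X Y} f := by
    have h : coprod.map (F.map f.f.1) f.f.2 ≫
        coprod.desc (F.map Y.hom ≫ adj.counit.app Y.right) (𝟙 Y.right) =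
        coprod.desc (F.map X.hom ≫ adj.counit.app X.right) (𝟙 X.right) ≫ f.f.2 :=
      congrArg Prod.snd f.h
    refine ⟨{ left := f.f.1, right := f.f.2, w := ?_ }, ?_⟩
    · exact (aux_nat adj X.hom Y.hom f.f.1 f.f.2).1 h
    · apply Monad.Algebra.Hom.ext
      rfl

lemma comparison_faithful : (Monad.comparison (freeAdj adj)).Faithful where
  map_injective {X Y} f g h := by
    have h' := congrArg Monad.Algebra.Hom.f h
    apply CommaMorphism.ext
    · exact congrArg Prod.fst h'
    · exact congrArg Prod.snd h'

lemma comparison_essSurj : (Monad.comparison (freeAdj adj)).EssSurj where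
  mem_essImage A := by
    let a2 : F.obj A.A.1 ⨿ A.A.2 ⟶ A.A.2 := A.a.2
    have h1 : 𝟙 A.A.1 ≫ A.a.1 = 𝟙 A.A.1 := congrArg Prod.fst A.unit
    have h2 : coprod.inr ≫ a2 = 𝟙 A.A.2 := congrArg Prod.snd A.unit
    let X : Comma (𝟭 D) G :=
      { left := A.A.1
        right := A.A.2
        hom := adj.unit.app A.A.1 ≫ G.map (coprod.inl ≫ a2) }
    have key : ((Monad.comparison (freeAdj adj)).obj X).a = A.a := by
      apply Prod.ext
      · change 𝟙 A.A.1 = A.a.1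
        rw [← h1]
        exact Category.id_comp _
      · exact aux_alg adj a2 h2
    refine ⟨X, ⟨Monad.Algebra.isoMk (Iso.refl A.A) ?_⟩⟩
    change (freeAdj adj).toMonad.map (𝟙 A.A) ≫ A.a =
      ((Monad.comparison (freeAdj adj)).obj X).a ≫ 𝟙 A.A
    rw [key]
    have h3 : (freeAdj adj).toMonad.map (𝟙 A.A) ≫ A.a = A.a := by
      rw [CategoryTheory.Functor.map_id, Category.id_comp]
    exact h3.trans (Category.comp_id A.a).symm

end SconeMonadic

/-- If `G : C ⥤ D` has a left adjoint `F` and `C` has binary coproducts, then the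
projection functor from the scone `Comma (𝟭 D) G` to `D × C` has a left adjoint
given on objects by `(d, c) ↦ (d, F d ⨿ c, G (coprod.inl) ∘ η_d)`, and it is
monadic. -/
theorem scone_projection_monadic
    {C : Type*} {D : Type*} [Category C] [Category D]
    [HasBinaryCoproducts C] (G : C ⥤ D) (F : D ⥤ C) (adj : F ⊣ G) :
    ∃ (L : D × C ⥤ Comma (𝟭 D) G)
      (_ : L ⊣ ((Comma.fst (𝟭 D) G).prod' (Comma.snd (𝟭 D) G))),
      (∀ (d : D) (c : C), (L.obj (d, c)).left = d) ∧
      (∀ (d : D) (c : C), (L.obj (d, c)).right = (F.obj d ⨿ c)) ∧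
      (∀ (d : D) (c : C), HEq (L.obj (d, c)).hom
        (adj.unit.app d ≫ G.map (coprod.inl : F.obj d ⟶ F.obj d ⨿ c))) ∧
      Nonempty (MonadicRightAdjoint
        ((Comma.fst (𝟭 D) G).prod' (Comma.snd (𝟭 D) G))) := by
  refine ⟨SconeMonadic.free adj, SconeMonadic.freeAdj adj, fun _ _ => rfl, fun _ _ => rfl,
    fun _ _ => HEq.rfl, ⟨?_⟩⟩
  exact
    { L := SconeMonadic.free adj
      adj := SconeMonadic.freeAdj adj
      eqv :=
        { faithful := SconeMonadic.comparison_faithful adj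
          full := SconeMonadic.comparison_full adj
          essSurj := SconeMonadic.comparison_essSurj adj } }
end

section
/- Let C and D be categories, with D having binary products and C having binary coproducts, and let G : C ⥤ D be a functor admitting a left adjoint. Then the projection functor P : Comma (𝟭 D) G ⥤ D × C creates all limits and all colimits (in particular, it strictly preserves them, and Comma (𝟭 D) G has any limits and colimits that D × C has). -/
open CategoryTheory CategoryTheory.Limits

universe w w' v₁ v₂ u₁ u₂

section Aux

variable {J : Type*} [Category J] {C D : Type*} [Category C] [Category D]

def sconeAuxConeFst {K : J ⥤ D × C} (c : Cone K) (s : Cone (K ⋙ CategoryTheory.Prod.fst D C)) :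
    Cone K :=
    { pt := (s.pt, c.pt.2)
      π :=
        { app := fun j => (s.π.app j, (c.π.app j).2)
          naturality := fun i j f => by
            have h1 := s.π.naturality f
            have h2 := congrArg (fun q => q.2) (c.π.naturality f)
            exact Prod.ext h1 h2 } }

def sconeIsLimitFst {K : J ⥤ D × C} {c : Cone K} (h : IsLimit c) :
    IsLimit ((CategoryTheory.Prod.fst D C).mapCone c) where
  lift s := (h.lift (sconeAuxConeFst c s)).1
  fac s j := congrArg (fun q => q.1) (h.fac (sconeAuxConeFst c s) j)
  uniq s m hm := congrArg (fun q => q.1) (h.uniq (sconeAuxConeFst c s) (m, 𝟙 c.pt.2)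
      (fun j => Prod.ext (hm j) (Category.id_comp _)))

def sconeAuxConeSnd {K : J ⥤ D × C} (c : Cone K) (s : Cone (K ⋙ CategoryTheory.Prod.snd D C)) :
    Cone K :=
    { pt := (c.pt.1, s.pt)
      π :=
        { app := fun j => ((c.π.app j).1, s.π.app j)
          naturality := fun i j f => by
            have h1 := s.π.naturality f
            have h2 := congrArg (fun q => q.1) (c.π.naturality f)
            exact Prod.ext h2 h1 } }

def sconeIsLimitSnd {K : J ⥤ D × C} {c : Cone K} (h : IsLimit c) :
    IsLimit ((CategoryTheory.Prod.snd D C).mapCone c) where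
  lift s := (h.lift (sconeAuxConeSnd c s)).2
  fac s j := congrArg (fun q => q.2) (h.fac (sconeAuxConeSnd c s) j)
  uniq s m hm := congrArg (fun q => q.2) (h.uniq (sconeAuxConeSnd c s) (𝟙 c.pt.1, m)
      (fun j => Prod.ext (Category.id_comp _) (hm j)))

def sconeAuxCoconeFst {K : J ⥤ D × C} (c : Cocone K) (s : Cocone (K ⋙ CategoryTheory.Prod.fst D C)) :
    Cocone K :=
    { pt := (s.pt, c.pt.2)
      ι :=
        { app := fun j => (s.ι.app j, (c.ι.app j).2)
          naturality := fun i j f => by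
            have h1 := s.ι.naturality f
            have h2 := congrArg (fun q => q.2) (c.ι.naturality f)
            exact Prod.ext h1 h2 } }

def sconeIsColimitFst {K : J ⥤ D × C} {c : Cocone K} (h : IsColimit c) :
    IsColimit ((CategoryTheory.Prod.fst D C).mapCocone c) where
  desc s := (h.desc (sconeAuxCoconeFst c s)).1
  fac s j := congrArg (fun q => q.1) (h.fac (sconeAuxCoconeFst c s) j)
  uniq s m hm := congrArg (fun q => q.1) (h.uniq (sconeAuxCoconeFst c s) (m, 𝟙 c.pt.2)
      (fun j => Prod.ext (hm j) (Category.comp_id _)))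

def sconeAuxCoconeSnd {K : J ⥤ D × C} (c : Cocone K) (s : Cocone (K ⋙ CategoryTheory.Prod.snd D C)) :
    Cocone K :=
    { pt := (c.pt.1, s.pt)
      ι :=
        { app := fun j => ((c.ι.app j).1, s.ι.app j)
          naturality := fun i j f => by
            have h1 := s.ι.naturality f
            have h2 := congrArg (fun q => q.1) (c.ι.naturality f)
            exact Prod.ext h2 h1 } }

def sconeIsColimitSnd {K : J ⥤ D × C} {c : Cocone K} (h : IsColimit c) :
    IsColimit ((CategoryTheory.Prod.snd D C).mapCocone c) where
  desc s := (h.desc (sconeAuxCoconeSnd c s)).2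
  fac s j := congrArg (fun q => q.2) (h.fac (sconeAuxCoconeSnd c s) j)
  uniq s m hm := congrArg (fun q => q.2) (h.uniq (sconeAuxCoconeSnd c s) (𝟙 c.pt.1, m)
      (fun j => Prod.ext (Category.comp_id _) (hm j)))

noncomputable def sconeCreatesLimit (G : C ⥤ D) (K : J ⥤ Comma (𝟭 D) G)
    [PreservesLimit (K ⋙ Comma.snd (𝟭 D) G) G] :
    CreatesLimit K ((Comma.fst (𝟭 D) G).prod' (Comma.snd (𝟭 D) G)) where
  reflects := fun {_} h =>
    ⟨Comma.fstSndJointlyReflectLimit (sconeIsLimitFst h) (sconeIsLimitSnd h)⟩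
  lifts c t :=
    { liftedCone := Comma.coneOfPreserves K
        (c₁ := (CategoryTheory.Prod.fst D C).mapCone c)
        (c₂ := (CategoryTheory.Prod.snd D C).mapCone c) (sconeIsLimitSnd t)
      validLift := Cone.ext (Iso.refl _) (fun j => (Category.id_comp _).symm) }

noncomputable def sconeCreatesColimit (G : C ⥤ D) (K : J ⥤ Comma (𝟭 D) G) :
    CreatesColimit K ((Comma.fst (𝟭 D) G).prod' (Comma.snd (𝟭 D) G)) where
  reflects := fun {_} h =>
    ⟨Comma.fstSndJointlyReflectColimit (sconeIsColimitFst h) (sconeIsColimitSnd h)⟩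
  lifts c t :=
    { liftedCocone := Comma.coconeOfPreserves K
        (c₁ := (CategoryTheory.Prod.fst D C).mapCocone c) (sconeIsColimitFst t)
        (c₂ := (CategoryTheory.Prod.snd D C).mapCocone c)
      validLift := Cocone.ext (Iso.refl _) (fun j => Category.comp_id _) }

end Aux

/-- If `D` has binary products, `C` has binary coproducts and `G : C ⥤ D` has a
left adjoint, then the projection functor from the scone `Comma (𝟭 D) G` to
`D × C` creates all limits and all colimits. -/
theorem scone_projection_creates_limits_and_colimits
    {C : Type u₁} {D : Type u₂} [Category.{v₁} C] [Category.{v₂} D]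
    [HasBinaryProducts D] [HasBinaryCoproducts C]
    (G : C ⥤ D) (F : D ⥤ C) (adj : F ⊣ G) :
    Nonempty (CreatesLimitsOfSize.{w, w'}
      ((Comma.fst (𝟭 D) G).prod' (Comma.snd (𝟭 D) G))) ∧
    Nonempty (CreatesColimitsOfSize.{w, w'}
      ((Comma.fst (𝟭 D) G).prod' (Comma.snd (𝟭 D) G))) := by
  have : PreservesLimitsOfSize.{w, w'} G := adj.rightAdjoint_preservesLimits
  exact ⟨⟨⟨fun {_} _ => ⟨fun {K} => sconeCreatesLimit G K⟩⟩⟩,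
    ⟨⟨fun {_} _ => ⟨fun {K} => sconeCreatesColimit G K⟩⟩⟩⟩
end
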